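/- arXiv:2302.12808 — 6 statements merged into one kernel-verified Lean document; each statement's English description precedes it below -/
import Mathlib

section
/- Lemma A.1 (global progress bound). For every x, y ∈ X and every γ ∈ [0, 1], setting y_γ = x + γ(y − x), it holds that φ(y_γ) ≤ F(f(x) + ∇f(x)(y_γ − x), y_γ) + (γ²/2)·S. -/
open Set

variable {d n : ℕ}

local notation "E" => EuclideanSpace ℝ (Fin d)
local notation "Rn" => EuclideanSpace ℝ (Fin n)

/-- Lemma A.1 (global progress bound). -/
theorem global_progress_bound
    (X : Set E) (hXconv : Convex ℝ X) (hXcomp : IsCompact X)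
    (f : E → Rn) (Df : E → (E →L[ℝ] Rn))
    (hf : ∀ x ∈ X, HasFDerivWithinAt f (Df x) X x)
    (F : Rn → E → ℝ)
    (hFconv : ConvexOn ℝ ((Set.univ : Set Rn) ×ˢ X) (fun p => F p.1 p.2))
    (hFsub : ∀ u : Rn, ∀ x ∈ X, ∀ γ : ℝ, 1 ≤ γ → F (γ • u) x ≤ γ * F u x)
    (S : ℝ) (hS0 : 0 ≤ S)
    (hS : ∀ x ∈ X, ∀ y ∈ X, ∀ γ ∈ Set.Ioc (0:ℝ) 1,
      F ((2 / γ ^ 2) • (f (x + γ • (y - x)) - f x - Df x (γ • (y - x)))) (x + γ • (y - x)) ≤ S)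
    (x : E) (hx : x ∈ X) (y : E) (hy : y ∈ X) (γ : ℝ) (hγ : γ ∈ Set.Icc (0:ℝ) 1) :
    F (f (x + γ • (y - x))) (x + γ • (y - x)) ≤
      F (f x + Df x ((x + γ • (y - x)) - x)) (x + γ • (y - x)) + γ ^ 2 / 2 * S := by
  rcases eq_or_lt_of_le hγ.1 with h0 | hpos
  · subst h0
    simp
  have hz : x + γ • (y - x) ∈ X := hXconv.add_smul_sub_mem hx hy hγ
  have hSz := hS x hx y hy γ ⟨hpos, hγ.2⟩
  rw [add_sub_cancel_left]
  generalize hzdef : x + γ • (y - x) = z at *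
  generalize Df x (γ • (y - x)) = v at *
  have hg2 : γ ^ 2 ≤ 1 := pow_le_one₀ hγ.1 hγ.2
  have hg0 : 0 < γ ^ 2 := by positivity
  have ht1 : 0 < 1 - γ ^ 2 / 2 := by linarith
  have ht0 : 0 ≤ γ ^ 2 / 2 := by linarith
  have hsub := hFsub (f x + v) z hz (1 - γ ^ 2 / 2)⁻¹
    ((one_le_inv₀ ht1).2 (by linarith))
  have hc := hFconv.2 (x := ((1 - γ ^ 2 / 2)⁻¹ • (f x + v), z))
    (y := ((2 / γ ^ 2) • (f z - f x - v), z)) ⟨mem_univ _, hz⟩ ⟨mem_univ _, hz⟩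
    ht1.le ht0 (by ring)
  simp only [Prod.fst_add, Prod.snd_add, Prod.smul_fst, Prod.smul_snd, smul_eq_mul] at hc
  have e1 : (1 - γ ^ 2 / 2) • (1 - γ ^ 2 / 2)⁻¹ • (f x + v)
      + (γ ^ 2 / 2) • (2 / γ ^ 2) • (f z - f x - v) = f z := by
    rw [smul_smul, smul_smul, mul_inv_cancel₀ ht1.ne',
      show γ ^ 2 / 2 * (2 / γ ^ 2) = 1 by field_simp, one_smul, one_smul]
    abel
  have e2 : (1 - γ ^ 2 / 2) • z + (γ ^ 2 / 2) • z = z := by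
    rw [← add_smul, sub_add_cancel, one_smul]
  rw [e1, e2] at hc
  have h1 := mul_le_mul_of_nonneg_left hsub ht1.le
  rw [mul_inv_cancel_left₀ ht1.ne'] at h1
  have h2 := mul_le_mul_of_nonneg_left hSz ht0
  linarith
end

section
/- One-step progress of the Basic Method (inequality (23)). Let y_k ∈ X, let x_{k+1} ∈ Argmin_{x ∈ X} F(f(y_k) + ∇f(y_k)(x − y_k), x), let Δ_k = φ(y_k) − F(f(y_k) + ∇f(y_k)(x_{k+1} − y_k), x_{k+1}), and for γ_k ∈ [0, 1] set y_{k+1} = (1 − γ_k) y_k + γ_k x_{k+1}. Then φ(y_k) − φ(y_{k+1}) ≥ γ_k·Δ_k − (γ_k²/2)·S. -/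
open Set

variable {d n : ℕ}

local notation "E" => EuclideanSpace ℝ (Fin d)
local notation "Rn" => EuclideanSpace ℝ (Fin n)

/-- One-step progress of the Basic Method (inequality (23)). -/
theorem basic_method_one_step
    (X : Set E) (hXconv : Convex ℝ X) (hXcomp : IsCompact X)
    (f : E → Rn) (Df : E → (E →L[ℝ] Rn))
    (hf : ∀ x ∈ X, HasFDerivWithinAt f (Df x) X x)
    (F : Rn → E → ℝ)
    (hFconv : ConvexOn ℝ ((Set.univ : Set Rn) ×ˢ X) (fun p => F p.1 p.2))
    (hFsub : ∀ u : Rn, ∀ x ∈ X, ∀ γ : ℝ, 1 ≤ γ → F (γ • u) x ≤ γ * F u x)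
    (S : ℝ) (hS0 : 0 ≤ S)
    (hS : ∀ x ∈ X, ∀ y ∈ X, ∀ γ ∈ Set.Ioc (0:ℝ) 1,
      F ((2 / γ ^ 2) • (f (x + γ • (y - x)) - f x - Df x (γ • (y - x)))) (x + γ • (y - x)) ≤ S)
    (yk xk1 : E) (hyk : yk ∈ X) (hxk1 : xk1 ∈ X)
    (hmin : ∀ w ∈ X, F (f yk + Df yk (xk1 - yk)) xk1 ≤ F (f yk + Df yk (w - yk)) w)
    (Δk : ℝ) (hΔ : Δk = F (f yk) yk - F (f yk + Df yk (xk1 - yk)) xk1)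
    (γ : ℝ) (hγ : γ ∈ Set.Icc (0:ℝ) 1)
    (yk1 : E) (hyk1 : yk1 = (1 - γ) • yk + γ • xk1) :
    F (f yk) yk - F (f yk1) yk1 ≥ γ * Δk - γ ^ 2 / 2 * S := by
  obtain ⟨h0, h1⟩ := hγ
  rcases h0.eq_or_lt with h | hpos
  · subst h
    simp [hyk1]
  have hz : yk1 = yk + γ • (xk1 - yk) := by rw [hyk1]; module
  have hzX : yk1 ∈ X := by
    rw [hyk1]; exact hXconv hyk hxk1 (by linarith) h0 (by ring)
  have hs := hS yk hyk xk1 hxk1 γ ⟨hpos, h1⟩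
  rw [← hz] at hs
  set r := f yk1 - f yk - Df yk (γ • (xk1 - yk)) with hr
  set v := (2 / γ ^ 2) • r with hv
  set u := f yk + γ • Df yk (xk1 - yk) with hu
  -- linear part
  have hA : F u yk1 ≤ (1 - γ) * F (f yk) yk + γ * F (f yk + Df yk (xk1 - yk)) xk1 := by
    have hcv := hFconv.2
    have := @hcv (f yk, yk) ⟨mem_univ _, hyk⟩ (f yk + Df yk (xk1 - yk), xk1)
      ⟨mem_univ _, hxk1⟩ (1 - γ) γ (by linarith) h0 (by ring)
    have e : (1 - γ) • f yk + γ • (f yk + Df yk (xk1 - yk)) = u := by rw [hu]; module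
    simp only [Prod.smul_mk, Prod.mk_add_mk, smul_eq_mul] at this
    rwa [e, ← hyk1] at this
  -- subadditivity
  have key : ∀ t : ℝ, 0 ≤ t → F (u + t • v) yk1 ≤ F u yk1 + t * F v yk1 := by
    intro t ht
    have hp : 0 < 1 + t := by linarith
    have hcv := hFconv.2
    have hc := @hcv (u, yk1) ⟨mem_univ _, hzX⟩ (v, yk1)
      ⟨mem_univ _, hzX⟩ (1 / (1 + t)) (t / (1 + t))
      (by positivity) (by positivity) (by field_simp)
    have e2 : (1 / (1 + t)) • yk1 + (t / (1 + t)) • yk1 = yk1 := by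
      rw [← add_smul, ← add_div, div_self hp.ne', one_smul]
    simp only [Prod.smul_mk, Prod.mk_add_mk, smul_eq_mul] at hc
    rw [e2] at hc
    have hh := hFsub ((1 / (1 + t)) • u + (t / (1 + t)) • v) yk1 hzX (1 + t) (by linarith)
    have e1 : (1 + t) • ((1 / (1 + t)) • u + (t / (1 + t)) • v) = u + t • v := by
      rw [smul_add, smul_smul, smul_smul, mul_div_cancel₀ _ hp.ne', mul_div_cancel₀ _ hp.ne',
        one_smul]
    rw [e1] at hh
    have h3 := mul_le_mul_of_nonneg_left hc hp.le
    have e3 : (1 + t) * (1 / (1 + t) * F u yk1 + t / (1 + t) * F v yk1)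
        = F u yk1 + t * F v yk1 := by field_simp
    linarith
  have hk := key (γ ^ 2 / 2) (by positivity)
  have e4 : u + (γ ^ 2 / 2) • v = f yk1 := by
    have : γ ^ 2 / 2 * (2 / γ ^ 2) = 1 := by field_simp
    rw [hv, smul_smul, this, one_smul, hr, hu, map_smul]
    abel
  rw [e4] at hk
  have h5 := mul_le_mul_of_nonneg_left hs (show 0 ≤ γ ^ 2 / 2 by positivity)
  rw [hΔ]
  linarith
end

section
/- Accuracy certificate bound (inequality (9)). Under Assumptions 1 and 3, for any y_k ∈ X and x_{k+1} ∈ Argmin_{x ∈ X} F(f(y_k) + ∇f(y_k)(x − y_k), x), the certificate Δ_k = φ(y_k) − F(f(y_k) + ∇f(y_k)(x_{k+1} − y_k), x_{k+1}) satisfies Δ_k ≥ max_{x ∈ X} [φ(y_k) − F(f(y_k) + ∇f(y_k)(x − y_k), x)] ≥ φ(y_k) − φ*, where φ* = min_{x ∈ X} φ(x). -/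
open Set

variable {d n : ℕ}

local notation "E" => EuclideanSpace ℝ (Fin d)
local notation "Rn" => EuclideanSpace ℝ (Fin n)

/-- Accuracy certificate bound (inequality (9)). -/
theorem certificate_bound
    (X : Set E) (hXconv : Convex ℝ X) (hXcomp : IsCompact X)
    (f : E → Rn) (Df : E → (E →L[ℝ] Rn))
    (hf : ∀ x ∈ X, HasFDerivWithinAt f (Df x) X x)
    (F : Rn → E → ℝ)
    (hFconv : ConvexOn ℝ ((Set.univ : Set Rn) ×ˢ X) (fun p => F p.1 p.2))
    (hFsub : ∀ u : Rn, ∀ x ∈ X, ∀ γ : ℝ, 1 ≤ γ → F (γ • u) x ≤ γ * F u x)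
    (hfconv : ∀ i : Fin n, ConvexOn ℝ X (fun z => f z i))
    (hFmono : ∀ x ∈ X, ∀ u v : Rn, (∀ i, u i ≤ v i) → F u x ≤ F v x)
    (φstar : ℝ) (hφstar : IsLeast ((fun z => F (f z) z) '' X) φstar)
    (yk xk1 : E) (hyk : yk ∈ X) (hxk1 : xk1 ∈ X)
    (hmin : ∀ w ∈ X, F (f yk + Df yk (xk1 - yk)) xk1 ≤ F (f yk + Df yk (w - yk)) w)
    (Δk : ℝ) (hΔ : Δk = F (f yk) yk - F (f yk + Df yk (xk1 - yk)) xk1) :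
    (∀ w ∈ X, F (f yk) yk - F (f yk + Df yk (w - yk)) w ≤ Δk) ∧
      F (f yk) yk - φstar ≤ Δk := by
  have key : ∀ w ∈ X, ∀ i, (f yk + Df yk (w - yk)) i ≤ f w i := by
    intro w hw i
    have hmaps : MapsTo (AffineMap.lineMap yk w : ℝ → E) (Icc (0:ℝ) 1) X := by
      intro t ht
      exact hXconv.lineMap_mem hyk hw ht
    have hc : ConvexOn ℝ (Icc (0:ℝ) 1) (fun t : ℝ => f (AffineMap.lineMap yk w t) i) :=
      ((hfconv i).comp_affineMap (AffineMap.lineMap yk w)).subset hmaps (convex_Icc 0 1)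
    have h0 : HasFDerivWithinAt f (Df yk) X (AffineMap.lineMap yk w (0:ℝ)) := by
      simpa using hf yk hyk
    have hd1 : HasDerivWithinAt (fun t : ℝ => f (AffineMap.lineMap yk w t))
        (Df yk (w - yk)) (Icc (0:ℝ) 1) 0 :=
      h0.comp_hasDerivWithinAt 0 AffineMap.hasDerivWithinAt_lineMap hmaps
    have hd : HasDerivWithinAt (fun t : ℝ => f (AffineMap.lineMap yk w t) i)
        ((Df yk (w - yk)) i) (Icc (0:ℝ) 1) 0 :=
      ((EuclideanSpace.proj i : Rn →L[ℝ] ℝ).hasFDerivAt).comp_hasDerivWithinAt 0 hd1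
    have := hc.le_slope_of_hasDerivWithinAt (x := 0) (y := 1) (by simp) (by simp) one_pos hd
    simp [slope] at this
    simp
    linarith
  have h1 : ∀ w ∈ X, F (f yk) yk - F (f yk + Df yk (w - yk)) w ≤ Δk := by
    intro w hw
    linarith [hmin w hw]
  refine ⟨h1, ?_⟩
  obtain ⟨z, hz, hzφ⟩ := hφstar.1
  have h2 := hFmono z hz _ _ (key z hz)
  have h3 := h1 z hz
  simp only at hzφ
  linarith
end

section
/- Bound on the curvature constant under Lipschitz gradients. Suppose each f_i has an L_i-Lipschitz continuous gradient on X (Assumption 2a) and F(·, x) is monotone for every x ∈ X. Then for all x, y ∈ X and γ ∈ (0, 1], with y_γ = x + γ(y − x), one has F((2/γ²)[f(y_γ) − f(x) − ∇f(x)(y_γ − x)], y_γ) ≤ sup_{z ∈ X} F(L·D_X², z), where L = (L_1, …, L_n) and D_X is the diameter of X; consequently the curvature constant S of Assumption 2 satisfies S ≤ sup_{z ∈ X} F(L·D_X², z). -/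
open Set

variable {d n : ℕ}

local notation "E" => EuclideanSpace ℝ (Fin d)
local notation "Rn" => EuclideanSpace ℝ (Fin n)

theorem descent_aux (X : Set E) (hXconv : Convex ℝ X) (g : E → ℝ) (Dg : E → (E →L[ℝ] ℝ))
    (hg : ∀ x ∈ X, HasFDerivWithinAt g (Dg x) X x) (l : ℝ)
    (hl : ∀ x ∈ X, ∀ y ∈ X, ‖Dg x - Dg y‖ ≤ l * ‖x - y‖)
    (x : E) (hx : x ∈ X) (w : E) (hw : x + w ∈ X) :
    g (x + w) - g x - Dg x w ≤ l / 2 * ‖w‖ ^ 2 := by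
  have hmem : ∀ t ∈ Icc (0:ℝ) 1, x + t • w ∈ X := fun t ht => hXconv.add_smul_mem hx hw ht
  have hder : ∀ t ∈ Icc (0:ℝ) 1, HasDerivWithinAt
      (fun t : ℝ => g (x + t • w) - t * Dg x w - l / 2 * ‖w‖ ^ 2 * t ^ 2)
      (Dg (x + t • w) w - Dg x w - l * ‖w‖ ^ 2 * t) (Icc 0 1) t := by
    intro t ht
    have h1 : HasDerivWithinAt (fun t : ℝ => x + t • w) w (Icc 0 1) t := by
      simpa using (((hasDerivAt_id t).smul_const w).const_add x).hasDerivWithinAt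
    have h2 := (hg _ (hmem t ht)).comp_hasDerivWithinAt t h1 hmem
    have h3 : HasDerivWithinAt (fun t : ℝ => t * Dg x w) (Dg x w) (Icc 0 1) t := by
      simpa using ((hasDerivAt_id t).mul_const (Dg x w)).hasDerivWithinAt
    have h4 : HasDerivWithinAt (fun t : ℝ => l / 2 * ‖w‖ ^ 2 * t ^ 2)
        (l * ‖w‖ ^ 2 * t) (Icc 0 1) t := by
      refine (((hasDerivAt_pow 2 t).const_mul (l / 2 * ‖w‖ ^ 2)).hasDerivWithinAt).congr_deriv ?_
      push_cast
      ring
    exact (h2.sub h3).sub h4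
  have hanti := antitoneOn_of_hasDerivWithinAt_nonpos (convex_Icc (0:ℝ) 1)
    (fun t ht => (hder t ht).continuousWithinAt)
    (fun t ht => (hder t (interior_subset ht)).mono interior_subset)
    (by
      intro t ht
      have ht := interior_subset ht
      have h := hl _ (hmem t ht) x hx
      rw [add_sub_cancel_left, norm_smul, Real.norm_of_nonneg ht.1] at h
      have h5 := (le_abs_self _).trans ((Dg (x + t • w) - Dg x).le_opNorm w)
      have h6 := mul_le_mul_of_nonneg_right h (norm_nonneg w)
      simp only [ContinuousLinearMap.sub_apply] at h5
      nlinarith)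
  have := hanti (left_mem_Icc.2 zero_le_one) (right_mem_Icc.2 zero_le_one) zero_le_one
  simp at this
  linarith

/-- Bound on the curvature constant under Lipschitz gradients. -/
theorem curvature_bound_of_lipschitz
    (X : Set E) (hXconv : Convex ℝ X) (hXcomp : IsCompact X)
    (f : E → Rn) (Df : E → (E →L[ℝ] Rn))
    (hf : ∀ x ∈ X, HasFDerivWithinAt f (Df x) X x)
    (F : Rn → E → ℝ)
    (hFconv : ConvexOn ℝ ((Set.univ : Set Rn) ×ˢ X) (fun p => F p.1 p.2))
    (hFsub : ∀ u : Rn, ∀ x ∈ X, ∀ γ : ℝ, 1 ≤ γ → F (γ • u) x ≤ γ * F u x)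
    (L : Rn)
    (hLip : ∀ i : Fin n, ∀ x ∈ X, ∀ y ∈ X,
      ‖(EuclideanSpace.proj i : Rn →L[ℝ] ℝ).comp (Df x) -
        (EuclideanSpace.proj i : Rn →L[ℝ] ℝ).comp (Df y)‖ ≤ L i * ‖x - y‖)
    (hFmono : ∀ x ∈ X, ∀ u v : Rn, (∀ i, u i ≤ v i) → F u x ≤ F v x)
    (DX : ℝ) (hDX : IsGreatest ((fun p : E × E => ‖p.1 - p.2‖) '' (X ×ˢ X)) DX)
    (M : ℝ) (hM : IsLUB ((fun z => F (DX ^ 2 • L) z) '' X) M)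
    (S : ℝ)
    (hScurv : IsLUB {v : ℝ | ∃ x ∈ X, ∃ y ∈ X, ∃ γ ∈ Set.Ioc (0:ℝ) 1,
      v = F ((2 / γ ^ 2) • (f (x + γ • (y - x)) - f x - Df x (γ • (y - x))))
        (x + γ • (y - x))} S) :
    (∀ x ∈ X, ∀ y ∈ X, ∀ γ ∈ Set.Ioc (0:ℝ) 1,
      F ((2 / γ ^ 2) • (f (x + γ • (y - x)) - f x - Df x (γ • (y - x))))
        (x + γ • (y - x)) ≤ M) ∧ S ≤ M := by
  have main : ∀ x ∈ X, ∀ y ∈ X, ∀ γ ∈ Set.Ioc (0:ℝ) 1,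
      F ((2 / γ ^ 2) • (f (x + γ • (y - x)) - f x - Df x (γ • (y - x))))
        (x + γ • (y - x)) ≤ M := by
    intro x hx y hy γ hγ
    have hmem : x + γ • (y - x) ∈ X :=
      hXconv.add_smul_sub_mem hx hy ⟨hγ.1.le, hγ.2⟩
    refine le_trans (hFmono _ hmem _ (DX ^ 2 • L) ?_) (hM.1 ⟨_, hmem, rfl⟩)
    intro i
    have h := descent_aux X hXconv (fun z => f z i)
      (fun z => (EuclideanSpace.proj i : Rn →L[ℝ] ℝ).comp (Df z))
      (fun z hz => (EuclideanSpace.proj i : Rn →L[ℝ] ℝ).hasFDerivAt.comp_hasFDerivWithinAt z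
        (hf z hz)) (L i) (hLip i) x hx (γ • (y - x)) hmem
    have hle : ‖y - x‖ ≤ DX := hDX.2 ⟨(y, x), ⟨hy, hx⟩, rfl⟩
    have hLD : L i * ‖y - x‖ ^ 2 ≤ L i * DX ^ 2 := by
      obtain ⟨⟨a, b⟩, ⟨ha, hb⟩, hab⟩ := hDX.1
      have h0 := (norm_nonneg _).trans (hLip i a ha b hb)
      simp only at hab
      rw [hab] at h0
      have hn := norm_nonneg (y - x)
      rcases (hn.trans hle).eq_or_lt with h1 | h1
      · have : ‖y - x‖ = 0 := le_antisymm (h1 ▸ hle) hn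
        rw [this, ← h1]
      · have : 0 ≤ L i := nonneg_of_mul_nonneg_left h0 h1
        gcongr
    rw [norm_smul, Real.norm_of_nonneg hγ.1.le] at h
    have hpos := hγ.1
    have h2 := mul_le_mul_of_nonneg_left h (by positivity : 0 ≤ 2 / γ ^ 2)
    have h3 : 2 / γ ^ 2 * (L i / 2 * (γ * ‖y - x‖) ^ 2) = L i * ‖y - x‖ ^ 2 := by
      field_simp
    rw [h3] at h2
    have h4 := h2.trans hLD
    simpa [mul_comm (L i)] using h4
  refine ⟨main, hScurv.2 ?_⟩
  rintro v ⟨x, hx, y, hy, γ, hγ, rfl⟩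
  exact main x hx y hy γ hγ
end

section
/- Quadratic upper bound under the outer function. Suppose Assumption 1 holds, each f_i has an L_i-Lipschitz continuous gradient on X (Assumption 2a), and F(·, x) is monotone for every x ∈ X. Then for all y, z ∈ X: F(f(y), y) ≤ F(f(z) + ∇f(z)(y − z), y) + (‖y − z‖₂²/2)·F(L, y), where L = (L_1, …, L_n). -/
open Set

variable {d n : ℕ}

local notation "E" => EuclideanSpace ℝ (Fin d)
local notation "Rn" => EuclideanSpace ℝ (Fin n)

/-- Quadratic upper bound under the outer function. -/
theorem quadratic_upper_bound
    (X : Set E) (hXconv : Convex ℝ X) (hXcomp : IsCompact X)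
    (f : E → Rn) (Df : E → (E →L[ℝ] Rn))
    (hf : ∀ x ∈ X, HasFDerivWithinAt f (Df x) X x)
    (F : Rn → E → ℝ)
    (hFconv : ConvexOn ℝ ((Set.univ : Set Rn) ×ˢ X) (fun p => F p.1 p.2))
    (hFsub : ∀ u : Rn, ∀ x ∈ X, ∀ γ : ℝ, 1 ≤ γ → F (γ • u) x ≤ γ * F u x)
    (L : Rn)
    (hLip : ∀ i : Fin n, ∀ x ∈ X, ∀ y ∈ X,
      ‖(EuclideanSpace.proj i : Rn →L[ℝ] ℝ).comp (Df x) -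
        (EuclideanSpace.proj i : Rn →L[ℝ] ℝ).comp (Df y)‖ ≤ L i * ‖x - y‖)
    (hFmono : ∀ x ∈ X, ∀ u v : Rn, (∀ i, u i ≤ v i) → F u x ≤ F v x) :
    ∀ y ∈ X, ∀ z ∈ X,
      F (f y) y ≤ F (f z + Df z (y - z)) y + ‖y - z‖ ^ 2 / 2 * F L y := by
  intro y hy z hz
  have hseg : ∀ t ∈ Icc (0:ℝ) 1, z + t • (y - z) ∈ X := fun t ht =>
    hXconv.add_smul_sub_mem hz hy ht
  have key : ∀ i, (f y) i ≤ (f z + Df z (y - z) + (‖y - z‖ ^ 2 / 2) • L) i := by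
    intro i
    have hder : ∀ t ∈ Icc (0:ℝ) 1, HasDerivWithinAt
        (fun t : ℝ => (f (z + t • (y - z))) i - t * (Df z (y - z)) i
          - L i * ‖y - z‖ ^ 2 / 2 * t ^ 2)
        ((Df (z + t • (y - z)) (y - z)) i - (Df z (y - z)) i - L i * ‖y - z‖ ^ 2 * t)
        (Icc 0 1) t := by
      intro t ht
      have h1 : HasDerivWithinAt (fun t : ℝ => z + t • (y - z)) (y - z) (Icc 0 1) t := by
        simpa using (((hasDerivAt_id t).smul_const (y - z)).const_add z).hasDerivWithinAt
      have h2 := (hf _ (hseg t ht)).comp_hasDerivWithinAt t h1 hseg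
      have h3 := (EuclideanSpace.proj i : Rn →L[ℝ] ℝ).hasFDerivAt.comp_hasDerivWithinAt t h2
      have h4 := ((hasDerivAt_id t).mul_const ((Df z (y - z)) i)).hasDerivWithinAt (s := Icc 0 1)
      have h5 := ((hasDerivAt_pow 2 t).const_mul
        (L i * ‖y - z‖ ^ 2 / 2)).hasDerivWithinAt (s := Icc 0 1)
      refine ((h3.sub h4).sub h5).congr_deriv ?_
      simp
      ring
    have hanti := antitoneOn_of_hasDerivWithinAt_nonpos (convex_Icc (0:ℝ) 1)
      (fun t ht => (hder t ht).continuousWithinAt)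
      (fun t ht => (hder t (interior_subset ht)).mono interior_subset)
      (by
        intro t ht
        have ht' := interior_subset ht
        have h := ContinuousLinearMap.le_of_opNorm_le _ (hLip i _ (hseg t ht') z hz) (y - z)
        have h' := (le_abs_self _).trans h
        simp [norm_smul, abs_of_nonneg ht'.1, -map_sub] at h'
        nlinarith [h'])
    have := hanti (left_mem_Icc.2 zero_le_one) (right_mem_Icc.2 zero_le_one) zero_le_one
    simp at this
    simp
    linarith
  refine (hFmono y hy _ _ key).trans ?_
  rcases eq_or_ne y z with rfl | hne
  · simp
  have hpos : 0 < ‖y - z‖ ^ 2 / 2 := by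
    have := norm_pos_iff.2 (sub_ne_zero.2 hne)
    positivity
  generalize ‖y - z‖ ^ 2 / 2 = c at *
  generalize f z + Df z (y - z) = u at *
  obtain ⟨t, ht0, ht1, htc⟩ : ∃ t : ℝ, 0 < t ∧ t < 1 ∧ t ≤ c :=
    ⟨min c (1/2), by positivity, (min_le_right _ _).trans_lt (by norm_num), min_le_left _ _⟩
  have h1t : 0 < 1 - t := by linarith
  have hc := hFconv.2 (x := ((1 - t)⁻¹ • u, y)) (by simp [hy]) (y := ((c / t) • L, y))
    (by simp [hy]) h1t.le ht0.le (by ring)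
  have e1 : (1 - t) • y + t • y = y := by rw [← add_smul]; simp
  have e2 : (1 - t) • (1 - t)⁻¹ • u + t • (c / t) • L = u + c • L := by
    rw [smul_smul, smul_smul, mul_inv_cancel₀ h1t.ne', mul_div_cancel₀ _ ht0.ne', one_smul]
  simp only [Prod.smul_mk, Prod.mk_add_mk, e1, e2, smul_eq_mul] at hc
  have s1 := hFsub u y hy (1 - t)⁻¹ ((one_le_inv₀ h1t).2 (by linarith))
  have s2 := hFsub L y hy (c / t) ((one_le_div ht0).2 htc)
  have s1' := mul_le_mul_of_nonneg_left s1 h1t.le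
  have s2' := mul_le_mul_of_nonneg_left s2 ht0.le
  rw [← mul_assoc, mul_inv_cancel₀ h1t.ne', one_mul] at s1'
  rw [← mul_assoc, mul_div_cancel₀ _ ht0.ne'] at s2'
  linarith
end

section
/- Telescoping lemma for the stepsize-weighted recursion (used in Theorems 1 and 4). Let S ≥ 0, let (φ_k)_{k ≥ 0} be a real sequence bounded below by φ*, and let (Δ_k)_{k ≥ 0} be real numbers with Δ_k ≥ φ_k − φ* for all k ≥ 0. Set A_k = k(k + 1) and a_{k+1} = A_{k+1} − A_k = 2(k + 1), and suppose that for every k ≥ 0: φ_k − φ_{k+1} ≥ (a_{k+1}/A_{k+1})·Δ_k − (a_{k+1}²/(2A_{k+1}²))·S. Then for every k ≥ 1: φ_k − φ* ≤ 2S/(k + 1) and min_{1 ≤ i ≤ k} Δ_i ≤ 6S/k. -/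
/-- Telescoping lemma for the stepsize-weighted recursion (used in Theorems 1 and 4). -/
theorem telescoping_recursion
    (S φstar : ℝ) (hS : 0 ≤ S)
    (φ Δ : ℕ → ℝ)
    (hlow : ∀ k, φstar ≤ φ k)
    (hΔ : ∀ k, φ k - φstar ≤ Δ k)
    (hstep : ∀ k : ℕ,
      φ k - φ (k + 1) ≥
        (2 * ((k : ℝ) + 1)) / (((k : ℝ) + 1) * ((k : ℝ) + 2)) * Δ k -
          (2 * ((k : ℝ) + 1)) ^ 2 / (2 * (((k : ℝ) + 1) * ((k : ℝ) + 2)) ^ 2) * S) :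
    ∀ k : ℕ, 1 ≤ k →
      (φ k - φstar ≤ 2 * S / ((k : ℝ) + 1) ∧
        ∃ i, 1 ≤ i ∧ i ≤ k ∧ Δ i ≤ 6 * S / (k : ℝ)) := by
  have hst : ∀ k : ℕ, ((k:ℝ)+1)*((k:ℝ)+2)*(φ (k+1) - φstar) ≤
      ((k:ℝ)+1)*((k:ℝ)+2)*(φ k - φstar) - 2*((k:ℝ)+1)*Δ k + 2*S := by
    intro k
    have hk : (0:ℝ) ≤ k := Nat.cast_nonneg k
    have h := mul_le_mul_of_nonneg_left (hstep k)
      (show 0 ≤ ((k:ℝ)+1)*((k:ℝ)+2) by positivity)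
    have e : ((k:ℝ)+1)*((k:ℝ)+2) * ((2 * ((k : ℝ) + 1)) / (((k : ℝ) + 1) * ((k : ℝ) + 2)) * Δ k -
          (2 * ((k : ℝ) + 1)) ^ 2 / (2 * (((k : ℝ) + 1) * ((k : ℝ) + 2)) ^ 2) * S)
        = 2*((k:ℝ)+1)*Δ k - 2*S + 2*S/((k:ℝ)+2) := by
      field_simp
      ring
    rw [e] at h
    have : 0 ≤ 2*S/((k:ℝ)+2) := by positivity
    linarith
  have h1 : ∀ k : ℕ, ((k:ℝ)+1) * (φ (k+1) - φstar) * ((k:ℝ)+2) ≤ 2*S*((k:ℝ)+1) := by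
    intro k
    induction k with
    | zero =>
      have := hst 0
      have := hΔ 0
      norm_num at *
      linarith
    | succ n ih =>
      have a := hst (n+1)
      have b := mul_le_mul_of_nonneg_left (hΔ (n+1)) (show 0 ≤ 2*((n:ℝ)+2) by positivity)
      push_cast at *
      linarith
  have h2 : ∀ k : ℕ, (φ (k+1) - φstar) * ((k:ℝ)+2) ≤ 2*S := by
    intro k
    have hk : (0:ℝ) < (k:ℝ)+1 := by positivity
    have := h1 k
    refine le_of_mul_le_mul_left ?_ hk
    linarith
  intro k hk
  have hk0 : (0:ℝ) < k := by exact_mod_cast hk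
  refine ⟨?_, ?_⟩
  · obtain ⟨n, rfl⟩ : ∃ n, k = n+1 := ⟨k-1, by omega⟩
    have := h2 n
    rw [le_div_iff₀ (by positivity)]
    push_cast
    linarith
  · by_contra! hc
    set M := 6*S/(k:ℝ) with hM
    have hMk : M * k = 6*S := by rw [hM]; field_simp
    rcases hS.eq_or_lt with h0 | hpos
    · have a := hc 1 le_rfl hk
      have b := hst 1
      have c := h2 0
      have d := hlow 2
      have hM0 : M = 0 := by rw [hM, ← h0]; simp
      norm_num at *
      linarith
    · have key : ∀ n : ℕ, n ≤ k → ((n:ℝ)+1)*((n:ℝ)+2)*(φ (n+1) - φstar) + M*(n*((n:ℝ)+3))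
          ≤ 2*S + 6*S*n := by
        intro n
        induction n with
        | zero =>
          intro _
          have := h1 0
          norm_num at *
          linarith
        | succ n ih =>
          intro hn
          have i1 := ih (by omega)
          have a := hst (n+1)
          have b := mul_le_mul_of_nonneg_left (hc (n+1) (by omega) hn).le
            (show 0 ≤ 2*((n:ℝ)+2) by positivity)
          have c := h2 n
          push_cast at *
          linarith
      have f := key k le_rfl
      have g : 0 ≤ ((k:ℝ)+1)*((k:ℝ)+2)*(φ (k+1) - φstar) :=
        mul_nonneg (by positivity) (sub_nonneg.2 (hlow _))
      have e : M*(k*((k:ℝ)+3)) = 6*S*(k+3) := by rw [← mul_assoc, hMk]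
      linarith
end
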